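/- Let A be a normal real n×n matrix (zero diagonal and all entries ≤ 0). If A ≤ A⊙A entrywise with strict inequality in some entry, i.e., there exist pairwise distinct i, j, k ∈ [n] with a_{ik} < a_{ij} + a_{jk}, then every x ∈ C_A satisfies (A⊙A)_{ik} ≤ x_i - x_k (an improvement of the defining inequality a_{ik} ≤ x_i - x_k). Consequently C_A = C_{A⊙A}. -/

import Mathlib

open Finset

/-- Tropical (max-plus) product of square real matrices: (A⊙B) i j = max_k (A i k + B k j). -/
def tmul {n : ℕ} (A B : Matrix (Fin (n+1)) (Fin (n+1)) ℝ) :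
    Matrix (Fin (n+1)) (Fin (n+1)) ℝ :=
  fun i j => univ.sup' univ_nonempty (fun k => A i k + B k j)

/-- Tropical column span of A: points x with x i = max_k (λ k + A i k) for some reals λ k. -/
def tspan {n : ℕ} (A : Matrix (Fin (n+1)) (Fin (n+1)) ℝ) : Set (Fin (n+1) → ℝ) :=
  { x | ∃ lam : Fin (n+1) → ℝ,
      ∀ i, x i = univ.sup' univ_nonempty (fun k => lam k + A i k) }

/-- The alcoved polytope C_A induced by a (zero-diagonal) matrix A, viewed inside
the hyperplane {x : x (last) = 0}. -/
def CA {n : ℕ} (A : Matrix (Fin (n+1)) (Fin (n+1)) ℝ) : Set (Fin (n+1) → ℝ) :=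
  { x | x (Fin.last n) = 0 ∧
      (∀ i, i ≠ Fin.last n → A i (Fin.last n) ≤ x i ∧ x i ≤ - A (Fin.last n) i) ∧
      (∀ i k, i ≠ Fin.last n → k ≠ Fin.last n → i ≠ k →
        A i k ≤ x i - x k ∧ x i - x k ≤ - A k i) }

theorem le_tmul {n : ℕ} (A B : Matrix (Fin (n+1)) (Fin (n+1)) ℝ) (i j k : Fin (n+1)) :
    A i j + B j k ≤ tmul A B i k :=
  Finset.le_sup' (fun j => A i j + B j k) (Finset.mem_univ j)

theorem tmul_le_iff {n : ℕ} (A B : Matrix (Fin (n+1)) (Fin (n+1)) ℝ) (i k : Fin (n+1)) (c : ℝ) :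
    tmul A B i k ≤ c ↔ ∀ j, A i j + B j k ≤ c := by
  simp [tmul]

theorem le_tmul_self {n : ℕ} {A : Matrix (Fin (n+1)) (Fin (n+1)) ℝ} (hdiag : ∀ i, A i i = 0)
    (i k : Fin (n+1)) : A i k ≤ tmul A A i k := by
  simpa [hdiag] using le_tmul A A i i k

theorem tmul_self_diag {n : ℕ} {A : Matrix (Fin (n+1)) (Fin (n+1)) ℝ}
    (hdiag : ∀ i, A i i = 0) (hneg : ∀ i j, A i j ≤ 0) (i : Fin (n+1)) : tmul A A i i = 0 :=
  le_antisymm ((tmul_le_iff A A i i 0).2 fun j => add_nonpos (hneg i j) (hneg j i))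
    (hdiag i ▸ le_tmul_self hdiag i i)

/-- For a zero-diagonal matrix, `CA A` is cut out by the inequalities `A i k ≤ x i - x k`
over all pairs of indices. -/
theorem mem_CA_iff {n : ℕ} {A : Matrix (Fin (n+1)) (Fin (n+1)) ℝ} (hdiag : ∀ i, A i i = 0)
    (x : Fin (n+1) → ℝ) :
    x ∈ CA A ↔ x (Fin.last n) = 0 ∧ ∀ i k, A i k ≤ x i - x k := by
  constructor
  · rintro ⟨h0, h1, h2⟩
    refine ⟨h0, fun i k => ?_⟩
    rcases eq_or_ne i k with rfl | hik
    · simp [hdiag]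
    by_cases hi : i = Fin.last n
    · subst hi
      linarith [(h1 k hik.symm).2]
    by_cases hk : k = Fin.last n
    · subst hk
      linarith [(h1 i hi).1]
    exact (h2 i k hi hk hik).1
  · rintro ⟨h0, h⟩
    refine ⟨h0, fun i _ => ⟨?_, ?_⟩, fun i k _ _ _ => ⟨h i k, ?_⟩⟩
    · linarith [h i (Fin.last n)]
    · linarith [h (Fin.last n) i]
    · linarith [h k i]

theorem tmul_self_le_sub {n : ℕ} {A : Matrix (Fin (n+1)) (Fin (n+1)) ℝ} {x : Fin (n+1) → ℝ}
    (h : ∀ i k, A i k ≤ x i - x k) (i k : Fin (n+1)) : tmul A A i k ≤ x i - x k :=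
  (tmul_le_iff A A i k _).2 fun j => by linarith [h i j, h j k]

/-- If A is normal and A < A⊙A in the (i,k) entry, witnessed by pairwise
distinct i, j, k with A i k < A i j + A j k, then every x ∈ C_A satisfies the
improved inequality (A⊙A) i k ≤ x i - x k; consequently C_A = C_{A⊙A}. -/
theorem CA_improved_and_eq_CA_sq (n : ℕ) (A : Matrix (Fin (n+1)) (Fin (n+1)) ℝ)
    (hdiag : ∀ i, A i i = 0) (hneg : ∀ i j, A i j ≤ 0)
    (i j k : Fin (n+1)) (hij : i ≠ j) (hjk : j ≠ k) (hik : i ≠ k)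
    (hlt : A i k < A i j + A j k) :
    (∀ x ∈ CA A, tmul A A i k ≤ x i - x k) ∧ CA A = CA (tmul A A) := by
  refine ⟨fun x hx => tmul_self_le_sub ((mem_CA_iff hdiag x).1 hx).2 i k, Set.ext fun x => ?_⟩
  rw [mem_CA_iff hdiag, mem_CA_iff (tmul_self_diag hdiag hneg)]
  exact and_congr_right fun _ =>
    ⟨tmul_self_le_sub, fun h i k => (le_tmul_self hdiag i k).trans (h i k)⟩
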